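/- arXiv:2310.11580 — 2 statements merged into one kernel-verified Lean document; each statement's English description precedes it below -/
import Mathlib

section
/- Let G be a graph with a vertex partition V(G) = A ∪ B such that every vertex of G has at most Δ(G)/100 neighbours in B, and A is an independent set. Then the edges of G can be decomposed into ⌈Δ(G)/2⌉ linear forests. -/
open SimpleGraph Set

namespace Paper

variable {V : Type*}

/-- Degree of a vertex, via the cardinality of its neighbour set. -/
noncomputable def deg (G : SimpleGraph V) (v : V) : ℕ := (G.neighborSet v).ncard

/-- A linear forest: an acyclic graph of maximum degree at most 2,
i.e. a disjoint union of paths. -/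
def IsLinearForest (G : SimpleGraph V) : Prop :=
  G.IsAcyclic ∧ ∀ v, deg G v ≤ 2

/-- Maximum degree. -/
noncomputable def maxDeg [Fintype V] (G : SimpleGraph V) : ℕ :=
  Finset.univ.sup fun v => deg G v

/-- Minimum degree. -/
noncomputable def minDeg [Fintype V] [Nonempty V] (G : SimpleGraph V) : ℕ :=
  Finset.univ.inf' Finset.univ_nonempty (deg G)

/-- A bipartition of a graph. -/
def IsBipartition (G : SimpleGraph V) (A B : Set V) : Prop :=
  Disjoint A B ∧ A ∪ B = Set.univ ∧
    ∀ u v, G.Adj u v → (u ∈ A ∧ v ∈ B) ∨ (u ∈ B ∧ v ∈ A)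

/-- The number of nontrivial (path) components of a linear forest. -/
noncomputable def numComponents (F : SimpleGraph V) : ℕ :=
  Nat.card {c : F.ConnectedComponent // (F.support ∩ c.supp).Nonempty}

section EdgeColoring

variable {W κ : Type*}

/-- `C` is a proper edge colouring of `H`; only the values on edges of `H` matter. -/
def IsProperEdgeColoring (H : SimpleGraph W) (C : Sym2 W → κ) : Prop :=
  ∀ u v w, H.Adj u v → H.Adj u w → C s(u, v) = C s(u, w) → v = w

/-- The colour `c` does not occur on the edges of `H` at `v`. -/
def IsMissing (H : SimpleGraph W) (C : Sym2 W → κ) (v : W) (c : κ) : Prop :=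
  ∀ w, H.Adj v w → C s(v, w) ≠ c

/-- The subgraph formed by the edges of colours `β` and `δ`. -/
def kempeGraph (H : SimpleGraph W) (C : Sym2 W → κ) (β δ : κ) : SimpleGraph W where
  Adj u w := H.Adj u w ∧ (C s(u, w) = β ∨ C s(u, w) = δ)
  symm := ⟨fun u w h => ⟨h.1.symm, by rw [Sym2.eq_swap]; exact h.2⟩⟩
  loopless := ⟨fun u h => h.1.ne rfl⟩

lemma false_of_connected_of_three_le_one [Finite W] {K : SimpleGraph W} (hK : K.Connected)
    (h2 : ∀ v, (K.neighborSet v).ncard ≤ 2) {x y z : W} (hxy : x ≠ y) (hxz : x ≠ z) (hyz : y ≠ z)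
    (hx : (K.neighborSet x).ncard ≤ 1) (hy : (K.neighborSet y).ncard ≤ 1)
    (hz : (K.neighborSet z).ncard ≤ 1) : False := by
  classical
  have := Fintype.ofFinite W
  have hcard := hK.card_vert_le_card_edgeSet_add_one
  have hdeg : ∀ v, (K.neighborSet v).ncard = K.degree v := fun v => by
    rw [Set.ncard_eq_toFinset_card', ← K.card_neighborFinset_eq_degree]; rfl
  simp only [hdeg] at *
  have hsum := K.sum_degrees_eq_twice_card_edges
  have hle : ∑ v, (K.degree v + if v ∈ ({x, y, z} : Finset W) then 1 else 0) ≤ ∑ _v : W, 2 := by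
    refine Finset.sum_le_sum fun v _ => ?_
    split_ifs with hv
    · simp only [Finset.mem_insert, Finset.mem_singleton] at hv
      rcases hv with rfl | rfl | rfl <;> omega
    · exact h2 v
  rw [Finset.sum_add_distrib, hsum, Finset.sum_ite_mem, Finset.univ_inter] at hle
  simp only [Finset.sum_const, Finset.card_univ, smul_eq_mul] at hle
  rw [Finset.card_eq_three.2 ⟨x, y, z, hxy, hxz, hyz, rfl⟩] at hle
  rw [Nat.card_eq_fintype_card, Nat.card_eq_fintype_card, ← K.edgeFinset_card] at hcard
  omega

lemma false_of_reachable_of_three_le_one [Finite W] {K : SimpleGraph W}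
    (h2 : ∀ v, (K.neighborSet v).ncard ≤ 2) {x y z : W} (hxy : x ≠ y) (hxz : x ≠ z) (hyz : y ≠ z)
    (hx : (K.neighborSet x).ncard ≤ 1) (hy : (K.neighborSet y).ncard ≤ 1)
    (hz : (K.neighborSet z).ncard ≤ 1) (hry : K.Reachable x y) (hrz : K.Reachable x z) :
    False := by
  let c := K.connectedComponentMk x
  have hle : ∀ v : c, (c.toSimpleGraph.neighborSet v).ncard ≤ (K.neighborSet v).ncard := fun v =>
    Set.ncard_le_ncard_of_injOn Subtype.val (fun w hw => hw) Subtype.val_injective.injOn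
      (Set.toFinite _)
  exact false_of_connected_of_three_le_one c.connected_toSimpleGraph
    (fun v => (hle v).trans (h2 v))
    (x := ⟨x, rfl⟩) (y := ⟨y, ConnectedComponent.sound hry.symm⟩)
    (z := ⟨z, ConnectedComponent.sound hrz.symm⟩)
    (fun h => hxy (congrArg Subtype.val h)) (fun h => hxz (congrArg Subtype.val h))
    (fun h => hyz (congrArg Subtype.val h))
    ((hle _).trans hx) ((hle _).trans hy) ((hle _).trans hz)

variable {H : SimpleGraph W} {C : Sym2 W → κ} {β δ : κ}

lemma IsProperEdgeColoring.injOn (hC : IsProperEdgeColoring H C) (v : W) :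
    Set.InjOn (fun w => C s(v, w)) (H.neighborSet v) :=
  fun _ hw _ hw' h => hC _ _ _ hw hw' h

lemma IsProperEdgeColoring.ncard_kempeGraph_le_two (hC : IsProperEdgeColoring H C) (v : W) :
    ((kempeGraph H C β δ).neighborSet v).ncard ≤ 2 :=
  (Set.ncard_le_ncard_of_injOn (fun w => C s(v, w)) (t := {β, δ}) (fun _ hw => hw.2)
    ((hC.injOn v).mono fun _ hw => hw.1) (Set.toFinite _)).trans (Set.ncard_insert_le _ _) |>.trans
    (by simp)

lemma IsProperEdgeColoring.ncard_kempeGraph_le_one_of_left (hC : IsProperEdgeColoring H C) {v : W}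
    (hv : IsMissing H C v β) : ((kempeGraph H C β δ).neighborSet v).ncard ≤ 1 :=
  (Set.ncard_le_ncard_of_injOn (fun w => C s(v, w)) (t := {δ})
    (fun w hw => hw.2.resolve_left (hv w hw.1))
    ((hC.injOn v).mono fun _ hw => hw.1) (Set.toFinite _)).trans (by simp)

lemma IsProperEdgeColoring.ncard_kempeGraph_le_one_of_right (hC : IsProperEdgeColoring H C) {v : W}
    (hv : IsMissing H C v δ) : ((kempeGraph H C β δ).neighborSet v).ncard ≤ 1 :=
  (Set.ncard_le_ncard_of_injOn (fun w => C s(v, w)) (t := {β})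
    (fun w hw => hw.2.resolve_right (hv w hw.1))
    ((hC.injOn v).mono fun _ hw => hw.1) (Set.toFinite _)).trans (by simp)

open Classical in
/-- Interchanging `β` and `δ` on the Kempe component of `v`. -/
lemma IsProperEdgeColoring.exists_swap (hC : IsProperEdgeColoring H C) (β δ : κ) (v : W) :
    ∃ C' : Sym2 W → κ, IsProperEdgeColoring H C' ∧ ∀ x w, H.Adj x w →
      C' s(x, w) = if (kempeGraph H C β δ).Reachable v x then Equiv.swap β δ (C s(x, w))
        else C s(x, w) := by
  set K := kempeGraph H C β δ with hK
  let C' : Sym2 W → κ := fun e =>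
    if ∃ x ∈ e, K.Reachable v x then Equiv.swap β δ (C e) else C e
  have key : ∀ x w, H.Adj x w →
      C' s(x, w) = if K.Reachable v x then Equiv.swap β δ (C s(x, w)) else C s(x, w) := by
    intro x w hxw
    by_cases hx : K.Reachable v x
    · simp [C', hx]
    · by_cases hw : K.Reachable v w
      · have hne : C s(x, w) ≠ β ∧ C s(x, w) ≠ δ := by
          rw [← not_or]
          intro h
          have hadj : K.Adj x w := ⟨hxw, h⟩
          exact hx (hw.trans hadj.symm.reachable)
        simp [C', hx, hw, Equiv.swap_apply_of_ne_of_ne hne.1 hne.2]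
      · simp [C', hx, hw]
  refine ⟨C', fun u x w hx hw h => ?_, key⟩
  rw [key u x hx, key u w hw] at h
  split_ifs at h
  · exact hC u x w hx hw ((Equiv.swap β δ).injective h)
  · exact hC u x w hx hw h

open Classical in
lemma IsProperEdgeColoring.sup_edge (hC : IsProperEdgeColoring H C) {u w : W} {c : κ}
    (hu : IsMissing H C u c) (hw : IsMissing H C w c) :
    IsProperEdgeColoring (H ⊔ edge u w) (Function.update C s(u, w) c) := by
  have aux : ∀ x y z, H.Adj x y → s(x, z) = s(u, w) → C s(x, y) ≠ c := by
    intro x y z hxy hxz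
    rcases Sym2.eq_iff.1 hxz with ⟨rfl, rfl⟩ | ⟨rfl, rfl⟩
    · exact hu y hxy
    · exact hw y hxy
  have adj : ∀ x y, (H ⊔ edge u w).Adj x y → s(x, y) ≠ s(u, w) → H.Adj x y := by
    intro x y h hne
    rcases h with h | h
    · exact h
    · rw [edge_adj] at h
      exact absurd (Sym2.eq_iff.2 h.1) hne
  intro x y z hy hz h
  by_cases h1 : s(x, y) = s(u, w) <;> by_cases h2 : s(x, z) = s(u, w)
  · have := h1.trans h2.symm
    rcases Sym2.eq_iff.1 this with ⟨_, h⟩ | ⟨h, h'⟩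
    · exact h
    · exact h'.trans h
  · rw [h1, Function.update_self, Function.update_of_ne h2] at h
    exact absurd h.symm (aux x z y (adj _ _ hz h2) h1)
  · rw [h2, Function.update_self, Function.update_of_ne h1] at h
    exact absurd h (aux x y z (adj _ _ hy h1) h2)
  · rw [Function.update_of_ne h1, Function.update_of_ne h2] at h
    exact hC x y z (adj _ _ hy h1) (adj _ _ hz h2) h

/-- A Kempe chain argument extending a proper colouring to the edge `va`. -/
lemma IsProperEdgeColoring.exists_sup_edge [Finite W] (hC : IsProperEdgeColoring H C)
    {v a b : W} {γ : κ} (hva : v ≠ a) (hab : a ≠ b) (hvb : H.Adj v b) (hγ : C s(v, b) = γ)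
    (haγ : IsMissing H C a γ) (haδ : IsMissing H C a δ) (hbδ : IsMissing H C b δ)
    (hvβ : IsMissing H C v β) :
    ∃ C' : Sym2 W → κ, IsProperEdgeColoring (H ⊔ edge v a) C' := by
  classical
  obtain ⟨C', hC', hswap⟩ := hC.exists_swap β δ v
  set K := kempeGraph H C β δ with hK
  have hvδ' : IsMissing H C' v δ := by
    intro w hw h
    rw [hswap v w hw, if_pos (Reachable.refl v), Equiv.swap_apply_eq_iff,
      Equiv.swap_apply_right] at h
    exact hvβ w hw h
  have hfix : ∀ x, ¬ K.Reachable v x → ∀ w, H.Adj x w → C' s(x, w) = C s(x, w) := by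
    intro x hx w hw
    rw [hswap x w hw, if_neg hx]
  by_cases hra : K.Reachable v a
  · have hrb : ¬ K.Reachable v b := fun hrb =>
      false_of_reachable_of_three_le_one (fun v => hC.ncard_kempeGraph_le_two v) hva hvb.ne hab
        (hC.ncard_kempeGraph_le_one_of_left hvβ) (hC.ncard_kempeGraph_le_one_of_right haδ)
        (hC.ncard_kempeGraph_le_one_of_right hbδ) hra hrb
    have hbδ' : IsMissing H C' b δ := fun w hw => by rw [hfix b hrb w hw]; exact hbδ w hw
    have hγβ : γ ≠ β := fun h => hvβ b hvb (hγ.trans h)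
    have hγδ : γ ≠ δ := fun h => hbδ v hvb.symm (by rw [Sym2.eq_swap, hγ, h])
    have hγ' : C' s(v, b) = γ := by rw [Sym2.eq_swap, hfix b hrb v hvb.symm, Sym2.eq_swap, hγ]
    have haγ' : IsMissing H C' a γ := by
      intro w hw h
      rw [hswap a w hw, if_pos hra, Equiv.swap_apply_eq_iff,
        Equiv.swap_apply_of_ne_of_ne hγβ hγδ] at h
      exact haγ w hw h
    have hD := hC'.sup_edge hvδ' hbδ'
    have hHb : H ⊔ edge v b = H := sup_eq_left.2 (by rw [edge_le_iff]; exact Or.inr hvb)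
    rw [hHb] at hD
    refine ⟨_, hD.sup_edge (u := v) (w := a) (c := γ) ?_ ?_⟩
    · intro w hw h
      by_cases hwb : w = b
      · subst hwb
        rw [Function.update_self] at h
        exact hγδ h.symm
      · rw [Function.update_of_ne (by simpa [hvb.ne] using hwb)] at h
        exact hwb (hC' v w b hw hvb (h.trans hγ'.symm))
    · intro w hw
      rw [Function.update_of_ne (by simp [hva.symm, hab])]
      exact haγ' w hw
  · exact ⟨_, hC'.sup_edge hvδ' fun w hw => by rw [hfix a hra w hw]; exact haδ w hw⟩

lemma exists_fin_notMem {k : ℕ} {X : Set (Fin k)} (hX : X.ncard < k) : ∃ c, c ∉ X := by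
  by_contra! h
  rw [Set.eq_univ_of_forall h, Set.ncard_univ, Nat.card_fin] at hX
  exact hX.false

lemma isMissing_iff {v : W} {c : κ} :
    IsMissing H C v c ↔ c ∉ (fun w => C s(v, w)) '' H.neighborSet v := by
  simp [IsMissing]

/-- A graph of maximum degree at most `k` in which every vertex has at most `d < k / 2` neighbours
outside an independent set `S` has chromatic index at most `k`. -/
theorem exists_isProperEdgeColoring [Finite W] {d k : ℕ} (hdk : 2 * d < k) (S : Set W)
    (H : SimpleGraph W) (hk : ∀ v, (H.neighborSet v).ncard ≤ k)
    (hd : ∀ v, (H.neighborSet v \ S).ncard ≤ d) (hS : ∀ a ∈ S, ∀ b ∈ S, ¬ H.Adj a b) :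
    ∃ C : Sym2 W → Fin k, IsProperEdgeColoring H C := by
  induction hn : H.edgeSet.ncard using Nat.strong_induction_on generalizing H with
  | _ n ih =>
  have extend : ∀ v a, H.Adj v a → ∃ H' : SimpleGraph W, H' ≤ H ∧ H' ⊔ edge v a = H ∧
      (H'.neighborSet v).ncard < (H.neighborSet v).ncard ∧
      ∃ C : Sym2 W → Fin k, IsProperEdgeColoring H' C := by
    intro v a hva
    have hle : H.deleteEdges {s(v, a)} ≤ H := H.deleteEdges_le _
    have hsub : ∀ x, (H.deleteEdges {s(v, a)}).neighborSet x ⊆ H.neighborSet x :=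
      fun x y hy => hle hy
    refine ⟨H.deleteEdges {s(v, a)}, hle, ?_, ?_, ?_⟩
    · ext x y
      simp only [sup_adj, deleteEdges_adj, edge_adj, Set.mem_singleton_iff, Sym2.eq_iff]
      constructor
      · rintro (h | ⟨⟨rfl, rfl⟩ | ⟨rfl, rfl⟩, _⟩)
        exacts [h.1, hva, hva.symm]
      · intro h
        have := h.ne
        tauto
    · refine Set.ncard_lt_ncard ⟨hsub v, fun h => ?_⟩ (Set.toFinite _)
      have := h (show a ∈ H.neighborSet v from hva)
      simp at this
    · refine ih _ ?_ (H.deleteEdges {s(v, a)})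
        (fun x => (Set.ncard_le_ncard (hsub x) (Set.toFinite _)).trans (hk x))
        (fun x => (Set.ncard_le_ncard (Set.sdiff_subset_sdiff_left (hsub x))
          (Set.toFinite _)).trans (hd x))
        (fun a ha b hb h => hS a ha b hb (hle h)) rfl
      rw [← hn]
      refine Set.ncard_lt_ncard ⟨edgeSet_mono hle, fun h => ?_⟩ (Set.toFinite _)
      have := h (show s(v, a) ∈ H.edgeSet from hva)
      simp at this
  have degS : ∀ a ∈ S, (H.neighborSet a).ncard ≤ d := fun a ha => by
    refine le_trans (Set.ncard_le_ncard (fun w hw => ?_) (Set.toFinite _)) (hd a)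
    exact ⟨hw, fun hwS => hS a ha w hwS hw⟩
  have used : ∀ (C : Sym2 W → Fin k) (X : Set W) (v : W),
      ((fun w => C s(v, w)) '' X).ncard ≤ X.ncard := fun C X v =>
    Set.ncard_image_le (Set.toFinite _)
  by_cases hedge : ∃ v a, H.Adj v a ∧ a ∈ S
  · obtain ⟨v, a, hva, haS⟩ := hedge
    obtain ⟨H', hle, hsup, hlt, C, hC⟩ := extend v a hva
    rw [← hsup]
    have hsub : ∀ x, H'.neighborSet x ⊆ H.neighborSet x := fun x y hy => hle hy
    have hmono : ∀ x, (H'.neighborSet x).ncard ≤ (H.neighborSet x).ncard :=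
      fun x => Set.ncard_le_ncard (hsub x) (Set.toFinite _)
    by_cases hcommon : ∃ c, IsMissing H' C v c ∧ IsMissing H' C a c
    · obtain ⟨c, hv, ha⟩ := hcommon
      classical exact ⟨_, hC.sup_edge hv ha⟩
    push Not at hcommon
    have hda := (hmono a).trans (degS a haS)
    obtain ⟨β, hβ⟩ := exists_fin_notMem
      (((used C (H'.neighborSet v) v).trans_lt hlt).trans_le (hk v))
    rw [← isMissing_iff] at hβ
    obtain ⟨γ, hγ⟩ : ∃ γ, γ ∉ (fun w => C s(a, w)) '' H'.neighborSet a ∪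
        (fun w => C s(v, w)) '' (H'.neighborSet v \ S) := by
      refine exists_fin_notMem ((Set.ncard_union_le _ _).trans_lt ?_)
      have h1 := used C (H'.neighborSet a) a
      have h2 := used C (H'.neighborSet v \ S) v
      have h3 := Set.ncard_le_ncard (Set.sdiff_subset_sdiff_left (t := S) (hsub v)) (Set.toFinite _)
      have h4 := hd v
      omega
    rw [Set.mem_union, not_or, ← isMissing_iff] at hγ
    obtain ⟨haγ, hvγ⟩ := hγ
    obtain ⟨b, hvb, hb⟩ : ∃ b, H'.Adj v b ∧ C s(v, b) = γ := by
      have := fun h => hcommon γ h haγ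
      simpa [IsMissing] using this
    have hbS : b ∈ S := by
      by_contra hbS
      exact hvγ ⟨b, ⟨hvb, hbS⟩, hb⟩
    have hab : a ≠ b := by
      rintro rfl
      exact haγ v hvb.symm (by rw [Sym2.eq_swap]; exact hb)
    obtain ⟨δ, hδ⟩ : ∃ δ, δ ∉ (fun w => C s(a, w)) '' H'.neighborSet a ∪
        (fun w => C s(b, w)) '' H'.neighborSet b := by
      refine exists_fin_notMem ((Set.ncard_union_le _ _).trans_lt ?_)
      have h1 := used C (H'.neighborSet a) a
      have h2 := used C (H'.neighborSet b) b
      have h3 := (hmono b).trans (degS b hbS)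
      omega
    rw [Set.mem_union, not_or, ← isMissing_iff, ← isMissing_iff] at hδ
    exact hC.exists_sup_edge hva.ne hab hvb hb haγ hδ.1 hδ.2 hβ
  · push Not at hedge
    by_cases hne : ∃ v a, H.Adj v a
    · obtain ⟨v, a, hva⟩ := hne
      obtain ⟨H', hle, hsup, -, C, hC⟩ := extend v a hva
      have hdeg : ∀ x, (H'.neighborSet x).ncard ≤ d := fun x =>
        (Set.ncard_le_ncard (t := H.neighborSet x \ S) (fun y hy => ⟨hle hy, hedge x y (hle hy)⟩)
          (Set.toFinite _)).trans (hd x)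
      obtain ⟨c, hc⟩ : ∃ c, c ∉ (fun w => C s(v, w)) '' H'.neighborSet v ∪
          (fun w => C s(a, w)) '' H'.neighborSet a := by
        refine exists_fin_notMem ((Set.ncard_union_le _ _).trans_lt ?_)
        have h1 := used C (H'.neighborSet v) v
        have h2 := used C (H'.neighborSet a) a
        have h3 := hdeg v
        have h4 := hdeg a
        omega
      rw [Set.mem_union, not_or, ← isMissing_iff, ← isMissing_iff] at hc
      rw [← hsup]
      classical exact ⟨_, hC.sup_edge hc.1 hc.2⟩
    · push Not at hne
      exact ⟨fun _ => ⟨0, by omega⟩, fun u v _ h => absurd h (hne u v)⟩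

end EdgeColoring

/-- A graph is acyclic if vertices of `B` have at most one neighbour in `B` and all other vertices
have at most one neighbour. -/
lemma isAcyclic_of_subsingleton_neighborSet {F : SimpleGraph V} (B : Set V)
    (hB : ∀ v ∈ B, (F.neighborSet v ∩ B).Subsingleton)
    (hA : ∀ v ∉ B, (F.neighborSet v).Subsingleton) : F.IsAcyclic := by
  classical
  intro v c hc
  have hmem : ∀ x ∈ c.support, x ∈ B := by
    intro x hx
    by_contra hxB
    have hr := hc.rotate hx
    exact hr.snd_ne_penultimate (hA x hxB (Walk.adj_snd hr.not_nil)
      (Walk.adj_penultimate hr.not_nil).symm)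
  exact hc.snd_ne_penultimate (hB v (hmem v c.start_mem_support)
    ⟨Walk.adj_snd hc.not_nil, hmem _ (c.getVert_mem_support _)⟩
    ⟨(Walk.adj_penultimate hc.not_nil).symm, hmem _ (c.getVert_mem_support _)⟩)

/-- Replace every vertex `v` by `(v, true)` and `(v, false)`, attaching each edge `vw` to the copy
`(v, f v w)`. -/
def splitGraph (G : SimpleGraph V) (f : V → V → Bool) : SimpleGraph (V × Bool) where
  Adj x y := G.Adj x.1 y.1 ∧ x.2 = f x.1 y.1 ∧ y.2 = f y.1 x.1
  symm := ⟨fun _ _ h => ⟨h.1.symm, h.2.2, h.2.1⟩⟩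
  loopless := ⟨fun _ h => h.1.ne rfl⟩

lemma ncard_neighborSet_splitGraph_inter_le [Finite V] (G : SimpleGraph V) (f : V → V → Bool)
    (X : Set V) (x : V × Bool) :
    ((splitGraph G f).neighborSet x ∩ Prod.fst ⁻¹' X).ncard ≤
      {w ∈ G.neighborSet x.1 ∩ X | f x.1 w = x.2}.ncard := by
  refine Set.ncard_le_ncard_of_injOn Prod.fst (fun y hy => ⟨⟨hy.1.1, hy.2⟩, hy.1.2.1.symm⟩) ?_
    (Set.toFinite _)
  rintro ⟨y, i⟩ hy ⟨z, j⟩ hz h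
  obtain rfl : y = z := h
  exact Prod.ext rfl (hy.1.2.2.trans hz.1.2.2.symm)

/-- The neighbourhoods can be halved with the prescribed parts in one half. -/
lemma exists_bool_halving [Finite V] (G : SimpleGraph V) (B : Set V) {k : ℕ}
    (hk : ∀ v, (G.neighborSet v).ncard ≤ 2 * k) (hB : ∀ v, (G.neighborSet v ∩ B).ncard ≤ k) :
    ∃ f : V → V → Bool, (∀ v w, G.Adj v w → w ∈ B → f v w = true) ∧
      ∀ v i, {w ∈ G.neighborSet v | f v w = i}.ncard ≤ k := by
  classical
  have hT : ∀ v, ∃ T ⊆ G.neighborSet v, G.neighborSet v ∩ B ⊆ T ∧ T.ncard ≤ k ∧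
      (G.neighborSet v \ T).ncard ≤ k := by
    intro v
    rcases le_total (G.neighborSet v).ncard k with h | h
    · exact ⟨_, subset_rfl, Set.inter_subset_left, h, by simp⟩
    · obtain ⟨T, h1, h2, h3⟩ :=
        Set.exists_subsuperset_card_eq (Set.inter_subset_left (t := B)) (hB v) h
      refine ⟨T, h2, h1, h3.le, ?_⟩
      have := hk v
      rw [Set.ncard_sdiff h2 (Set.toFinite _)]
      omega
  choose T hTN hBT hTk hTk' using hT
  refine ⟨fun v w => decide (w ∈ T v), fun v w hvw hw => by simpa using hBT v ⟨hvw, hw⟩, ?_⟩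
  rintro v (_ | _)
  · exact (Set.ncard_le_ncard (t := G.neighborSet v \ T v) (fun w hw => ⟨hw.1, by simpa using hw.2⟩)
      (Set.toFinite _)).trans (hTk' v)
  · exact (Set.ncard_le_ncard (fun w hw => by simpa using hw.2) (Set.toFinite _)).trans (hTk v)

/-- The edges of `G` whose image in the split graph has colour `i`. -/
def splitColorClass {κ : Type*} (G : SimpleGraph V) (f : V → V → Bool) (C : Sym2 (V × Bool) → κ)
    (i : κ) : SimpleGraph V where
  Adj u v := G.Adj u v ∧ C s((u, f u v), (v, f v u)) = i
  symm := ⟨fun _ _ h => ⟨h.1.symm, by rw [Sym2.eq_swap]; exact h.2⟩⟩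
  loopless := ⟨fun _ h => h.1.ne rfl⟩

lemma IsProperEdgeColoring.eq_of_splitColorClass_adj {κ : Type*} {G : SimpleGraph V}
    {f : V → V → Bool} {C : Sym2 (V × Bool) → κ} (hC : IsProperEdgeColoring (splitGraph G f) C)
    {i : κ} {u v w : V} (hv : (splitColorClass G f C i).Adj u v)
    (hw : (splitColorClass G f C i).Adj u w) (h : f u v = f u w) : v = w := by
  have := hC (u, f u v) (v, f v u) (w, f w u) ⟨hv.1, rfl, rfl⟩ ⟨hw.1, h, rfl⟩
    (by rw [hv.2, h, hw.2])
  exact congrArg Prod.fst this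

lemma IsProperEdgeColoring.isLinearForest_splitColorClass {κ : Type*} {G : SimpleGraph V}
    {f : V → V → Bool} {C : Sym2 (V × Bool) → κ} (hC : IsProperEdgeColoring (splitGraph G f) C)
    {B : Set V} (hf : ∀ v w, G.Adj v w → w ∈ B → f v w = true)
    (hB : ∀ v w, G.Adj v w → v ∉ B → w ∈ B) (i : κ) :
    IsLinearForest (splitColorClass G f C i) := by
  refine ⟨isAcyclic_of_subsingleton_neighborSet B ?_ ?_, fun v => ?_⟩
  · intro v _ x hx y hy
    exact hC.eq_of_splitColorClass_adj hx.1 hy.1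
      ((hf v x hx.1.1 hx.2).trans (hf v y hy.1.1 hy.2).symm)
  · intro v hv x hx y hy
    exact hC.eq_of_splitColorClass_adj hx hy
      ((hf v x hx.1 (hB v x hx.1 hv)).trans (hf v y hy.1 (hB v y hy.1 hv)).symm)
  · refine (Set.ncard_le_ncard_of_injOn (f v) (t := Set.univ) (fun _ _ => Set.mem_univ _)
      (fun x hx y hy h => hC.eq_of_splitColorClass_adj hx hy h) (Set.toFinite _)).trans ?_
    simp


/-- if every vertex has at most `Δ(G)/100` neighbours in `B` and
`A` is independent, the edges of `G` decompose into `⌈Δ(G)/2⌉` linear forests. -/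
theorem linear_forest_decomposition_with_bad_set [Fintype V]
    (G : SimpleGraph V) (A B : Set V)
    (hdisj : Disjoint A B) (hcover : A ∪ B = Set.univ)
    (hdegB : ∀ v, 100 * (G.neighborSet v ∩ B).ncard ≤ maxDeg G)
    (hA : ∀ a ∈ A, ∀ a' ∈ A, ¬ G.Adj a a') :
    ∃ F : Fin ((maxDeg G + 1) / 2) → SimpleGraph V,
      (∀ i, F i ≤ G ∧ IsLinearForest (F i)) ∧
      (∀ i j, i ≠ j → Disjoint (F i).edgeSet (F j).edgeSet) ∧
      (⋃ i, (F i).edgeSet) = G.edgeSet := by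
  set k := (maxDeg G + 1) / 2 with hk
  have hdeg : ∀ v, (G.neighborSet v).ncard ≤ maxDeg G := fun v =>
    Finset.le_sup (f := fun v => deg G v) (Finset.mem_univ v)
  have hBA : ∀ v, v ∉ B ↔ v ∈ A := fun v => by
    have h := hcover.symm ▸ Set.mem_univ v
    exact ⟨h.resolve_right, fun ha hb => hdisj.le_bot ⟨ha, hb⟩⟩
  have hB : ∀ v w, G.Adj v w → v ∉ B → w ∈ B := fun v w hvw hv => by
    by_contra hw
    exact hA v ((hBA v).1 hv) w ((hBA w).1 hw) hvw
  rcases Nat.eq_zero_or_pos (maxDeg G) with h0 | hpos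
  · have hbot : G = ⊥ := by
      ext u v
      have hu : G.neighborSet u = ∅ := by
        rw [← Set.ncard_eq_zero (Set.toFinite _)]
        exact Nat.le_zero.1 (h0 ▸ hdeg u)
      exact iff_of_false (fun h => (hu ▸ h : v ∈ (∅ : Set V))) not_false
    have : IsEmpty (Fin k) := ⟨fun i => by have := i.isLt; omega⟩
    exact ⟨isEmptyElim, isEmptyElim, isEmptyElim, by simp [hbot]⟩
  obtain ⟨f, hfB, hfk⟩ := exists_bool_halving G B (k := k)
    (fun v => (hdeg v).trans (by omega)) (fun v => by have := hdegB v; omega)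
  obtain ⟨C, hC⟩ : ∃ C : Sym2 (V × Bool) → Fin k, IsProperEdgeColoring (splitGraph G f) C := by
    refine exists_isProperEdgeColoring (d := maxDeg G / 100) (by omega)
      (Prod.fst ⁻¹' Bᶜ) (splitGraph G f) (fun x => ?_) (fun x => ?_) ?_
    · have := ncard_neighborSet_splitGraph_inter_le G f Set.univ x
      simp only [Set.preimage_univ, Set.inter_univ] at this
      exact this.trans (hfk _ _)
    · have := ncard_neighborSet_splitGraph_inter_le G f B x
      rw [Set.preimage_compl, Set.sdiff_compl]
      have h1 := Set.ncard_le_ncard (Set.sep_subset (G.neighborSet x.1 ∩ B) (f x.1 · = x.2))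
        (Set.toFinite _)
      have h2 := hdegB x.1
      omega
    · exact fun x hx y hy h => hy (hB x.1 y.1 h.1 hx)
  refine ⟨splitColorClass G f C, fun i => ⟨fun u v h => h.1,
    hC.isLinearForest_splitColorClass hfB hB i⟩, fun i j hij => ?_, ?_⟩
  · rw [Set.disjoint_left]
    intro e
    induction e with
    | _ u v => exact fun hi hj => hij (hi.2.symm.trans hj.2)
  · ext e
    induction e with
    | _ u v => simp [splitColorClass]
end Paper
end

section
/- For every ε > 0 there exists Δ₀ such that for all Δ ≥ Δ₀, every graph with maximum degree at most Δ can be edge-decomposed into at most (1+ε)Δ/2 linear forests. -/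
open SimpleGraph Set

namespace Paper

variable {V : Type*}

/-- `F` is a decomposition of the edges of `G` into linear forests. -/
def IsLinearForestDecomp {ι : Type*} (G : SimpleGraph V) (F : ι → SimpleGraph V) : Prop :=
  (∀ i, F i ≤ G ∧ IsLinearForest (F i)) ∧ ∀ u v, G.Adj u v → ∃! i, (F i).Adj u v

theorem IsLinearForestDecomp.of_partition {κ ι : Type*} {G : SimpleGraph V}
    {H : κ → SimpleGraph V} (hle : ∀ k, H k ≤ G) (hH : ∀ u v, G.Adj u v → ∃! k, (H k).Adj u v)
    {F : κ → ι → SimpleGraph V} (hF : ∀ k, IsLinearForestDecomp (H k) (F k)) :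
    IsLinearForestDecomp G (fun x : κ × ι => F x.1 x.2) := by
  refine ⟨fun x => ⟨((hF x.1).1 x.2).1.trans (hle _), ((hF x.1).1 x.2).2⟩, fun u v h => ?_⟩
  obtain ⟨k, hk, hk'⟩ := hH u v h
  obtain ⟨i, hi, hi'⟩ := (hF k).2 u v hk
  refine ⟨(k, i), hi, ?_⟩
  rintro ⟨k₁, i₁⟩ h₁
  obtain rfl : k₁ = k := hk' _ (((hF k₁).1 i₁).1 h₁)
  rw [hi' i₁ h₁]

open Classical in
/-- A square matrix of natural numbers with constant line sums `D` is a sum of `D` permutation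
matrices. -/
theorem exists_perms_of_line_sums {α : Type*} [Fintype α] (D : ℕ) (M : α → α → ℕ)
    (hrow : ∀ a, ∑ b, M a b = D) (hcol : ∀ b, ∑ a, M a b = D) :
    ∃ σ : Fin D → Equiv.Perm α, ∀ a b, M a b = ∑ j, if σ j a = b then 1 else 0 := by
  induction D generalizing M with
  | zero =>
    refine ⟨fun i => i.elim0, fun a b => ?_⟩
    have := hrow a
    rw [Finset.sum_eq_zero_iff] at this
    simpa using this b (Finset.mem_univ b)
  | succ D ih =>
    have hall : ∀ S : Finset α,
        S.card ≤ (S.biUnion fun a => Finset.univ.filter fun b => 0 < M a b).card := by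
      intro S
      set T := S.biUnion fun a => Finset.univ.filter fun b => 0 < M a b with hT
      have h1 : (D + 1) * S.card ≤ (D + 1) * T.card := by
        calc (D + 1) * S.card = ∑ a ∈ S, ∑ b, M a b := by
              simp [hrow, mul_comm]
          _ = ∑ a ∈ S, ∑ b ∈ T, M a b := by
              refine Finset.sum_congr rfl fun a ha => ?_
              refine (Finset.sum_subset (Finset.subset_univ _) fun b _ hb => ?_).symm
              by_contra hne
              exact hb (Finset.mem_biUnion.2 ⟨a, ha, by simp [Nat.pos_of_ne_zero hne]⟩)
          _ = ∑ b ∈ T, ∑ a ∈ S, M a b := Finset.sum_comm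
          _ ≤ ∑ b ∈ T, ∑ a, M a b := Finset.sum_le_sum fun b _ =>
              Finset.sum_le_sum_of_subset (Finset.subset_univ _)
          _ = (D + 1) * T.card := by simp [hcol, mul_comm]
      exact Nat.le_of_mul_le_mul_left h1 (Nat.succ_pos D)
    obtain ⟨f, hf, hfM⟩ := (Finset.all_card_le_biUnion_card_iff_exists_injective _).1 hall
    let τ : Equiv.Perm α := Equiv.ofBijective f (Finite.injective_iff_bijective.1 hf)
    have hτ : ∀ a, 0 < M a (τ a) := fun a => by simpa [τ] using hfM a
    have hsub : ∀ a b, (M a b - if τ a = b then 1 else 0) + (if τ a = b then 1 else 0) = M a b := by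
      intro a b
      split_ifs with h
      · subst h; have := hτ a; omega
      · simp
    obtain ⟨σ, hσ⟩ := ih (fun a b => M a b - if τ a = b then 1 else 0)
      (fun a => by
        have h := hrow a
        rw [← Finset.sum_congr rfl fun b _ => hsub a b, Finset.sum_add_distrib,
          Finset.sum_ite_eq, if_pos (Finset.mem_univ _)] at h
        exact Nat.succ_injective h)
      (fun b => by
        have h := hcol b
        have h2 : ∑ a, (if τ a = b then 1 else 0) = 1 := by
          simp [← Equiv.eq_symm_apply]
        rw [← Finset.sum_congr rfl fun a _ => hsub a b, Finset.sum_add_distrib, h2] at h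
        exact Nat.succ_injective h)
    refine ⟨Fin.cons τ σ, fun a b => ?_⟩
    rw [Fin.sum_univ_succ, ← hsub a b, hσ]
    simp [add_comm]

open Classical in
/-- König's theorem for relations of bounded row and column degrees. -/
theorem exists_perms_of_relation [Fintype V] (R : V → V → Prop) (D : ℕ)
    (hout : ∀ u, (Finset.univ.filter fun v => R u v).card ≤ D)
    (hin : ∀ v, (Finset.univ.filter fun u => R u v).card ≤ D) :
    ∃ σ : Fin D → Equiv.Perm (V ⊕ V),
      ∀ u v, R u v → ∃! j, σ j (Sum.inl u) = Sum.inl v := by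
  let r : V → V → ℕ := fun u v => if R u v then 1 else 0
  have ho : ∀ u, ∑ v, r u v ≤ D := fun u => by simpa [r] using hout u
  have hi : ∀ v, ∑ u, r u v ≤ D := fun v => by simpa [r] using hin v
  let M : V ⊕ V → V ⊕ V → ℕ := fun x y => match x, y with
    | .inl u, .inl v => r u v
    | .inl u, .inr v => if u = v then D - ∑ w, r u w else 0
    | .inr u, .inl v => if u = v then D - ∑ w, r w u else 0
    | .inr u, .inr v => r v u
  obtain ⟨σ, hσ⟩ := exists_perms_of_line_sums D M
    (by rintro (u | u)
        · have := ho u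
          simp [M]; omega
        · have := hi u
          simp [M]; omega)
    (by rintro (u | u)
        · have := hi u
          simp [M]; omega
        · have := ho u
          simp [M]; omega)
  refine ⟨σ, fun u v huv => ?_⟩
  have h := hσ (Sum.inl u) (Sum.inl v)
  simp only [M, r, huv, if_true] at h
  have h' : (Finset.univ.filter fun j => σ j (Sum.inl u) = Sum.inl v).card = 1 := by
    rw [Finset.card_filter]
    convert h.symm
  obtain ⟨j, hj⟩ := Finset.card_eq_one.1 h'
  simp only [Finset.ext_iff, Finset.mem_filter, Finset.mem_univ, true_and,
    Finset.mem_singleton] at hj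
  exact ⟨j, (hj j).2 rfl, fun j' => (hj j').1⟩

/-- The graph of the partial injection induced by `σ`, restricted to the edges of `G` along which
`ℓ` increases. -/
def increasingGraph (G : SimpleGraph V) (ℓ : V → ℕ) (σ : Equiv.Perm (V ⊕ V)) : SimpleGraph V where
  Adj u v := G.Adj u v ∧ ((ℓ u < ℓ v ∧ σ (Sum.inl u) = Sum.inl v) ∨
    (ℓ v < ℓ u ∧ σ (Sum.inl v) = Sum.inl u))
  symm := ⟨fun _ _ h => ⟨h.1.symm, h.2.symm⟩⟩
  loopless := ⟨fun _ h => h.1.ne rfl⟩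

theorem isLinearForest_increasingGraph (G : SimpleGraph V) (ℓ : V → ℕ)
    (σ : Equiv.Perm (V ⊕ V)) : IsLinearForest (increasingGraph G ℓ σ) := by
  classical
  constructor
  · intro v c hc
    obtain ⟨u, hu, hmax⟩ := Finset.exists_max_image c.support.toFinset ℓ ⟨v, by simp⟩
    rw [List.mem_toFinset] at hu
    have hc' := hc.rotate hu
    have hs : ∀ w ∈ (c.rotate u hu).support, ℓ w ≤ ℓ u := fun w hw =>
      hmax w (by simpa using (Walk.mem_support_rotate_iff _ _ hu).1 hw)
    have key : ∀ w, (increasingGraph G ℓ σ).Adj u w → w ∈ (c.rotate u hu).support →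
        σ (Sum.inl w) = Sum.inl u := by
      rintro w ⟨-, h | h⟩ hw
      · exact absurd (hs w hw) (not_le.2 h.1)
      · exact h.2
    have h1 := key _ (Walk.adj_snd hc'.not_nil) (Walk.getVert_mem_support _ _)
    have h2 := key _ (Walk.adj_penultimate hc'.not_nil).symm (Walk.getVert_mem_support _ _)
    exact hc'.snd_ne_penultimate (Sum.inl_injective (σ.injective (h1.trans h2.symm)))
  · intro u
    have hsub : (increasingGraph G ℓ σ).neighborSet u ⊆
        {v | σ (Sum.inl u) = Sum.inl v} ∪ {v | σ (Sum.inl v) = Sum.inl u} := by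
      rintro v ⟨-, h | h⟩
      · exact Or.inl h.2
      · exact Or.inr h.2
    have h1 : ({v | σ (Sum.inl u) = Sum.inl v} : Set V).Subsingleton := fun a ha b hb =>
      Sum.inl_injective (Eq.trans (Eq.symm ha) hb)
    have h2 : ({v | σ (Sum.inl v) = Sum.inl u} : Set V).Subsingleton := fun a ha b hb =>
      Sum.inl_injective (σ.injective (Eq.trans ha (Eq.symm hb)))
    calc deg _ u ≤ _ := ncard_le_ncard hsub (h1.finite.union h2.finite)
      _ ≤ _ := ncard_union_le _ _
      _ ≤ 1 + 1 := add_le_add ((ncard_le_one h1.finite).2 h1) ((ncard_le_one h2.finite).2 h2)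

open Classical in
/-- A graph in which every vertex has at most `D` neighbours above it and at most `D` below it,
with respect to a labelling that is proper on edges, decomposes into `D` linear forests. -/
theorem exists_decomp_of_labelling [Fintype V] (G : SimpleGraph V) (ℓ : V → ℕ) (D : ℕ)
    (hne : ∀ u v, G.Adj u v → ℓ u ≠ ℓ v)
    (hup : ∀ u, (Finset.univ.filter fun v => G.Adj u v ∧ ℓ u < ℓ v).card ≤ D)
    (hdown : ∀ v, (Finset.univ.filter fun u => G.Adj u v ∧ ℓ u < ℓ v).card ≤ D) :
    ∃ F : Fin D → SimpleGraph V, IsLinearForestDecomp G F := by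
  obtain ⟨σ, hσ⟩ := exists_perms_of_relation (fun u v => G.Adj u v ∧ ℓ u < ℓ v) D
    (by convert hup) (by convert hdown)
  refine ⟨fun j => increasingGraph G ℓ (σ j), fun j => ⟨fun u v h => h.1,
    isLinearForest_increasingGraph G ℓ _⟩, ?_⟩
  have key : ∀ u v, G.Adj u v → ℓ u < ℓ v → ∃! j, (increasingGraph G ℓ (σ j)).Adj u v := by
    intro u v h hlt
    refine (existsUnique_congr fun j => ?_).2 (hσ u v ⟨h, hlt⟩)
    simp [increasingGraph, h, hlt, hlt.le]
  intro u v h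
  rcases lt_or_gt_of_ne (hne u v h) with hlt | hlt
  · exact key u v h hlt
  · simpa only [SimpleGraph.adj_comm] using key v u h.symm hlt

/-- The index of the colour pair `x, y` in the zigzag decomposition of the complete graph on
`2 * n` colours into `n` Hamiltonian paths; pairs of equal colours have index `n`. -/
def zigzagIndex (n x y : ℕ) : ℕ :=
  if x = y then n else (if x + y < 2 * n then x + y else x + y - 2 * n) / 2

/-- The position of the colour `x` on the `i`-th path of the zigzag decomposition. -/
def zigzagLevel (n i x : ℕ) : ℕ :=
  if i ≤ x then (if x - i ≤ n then 2 * (x - i) - 1 else 2 * (2 * n - (x - i)))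
  else (if x + 2 * n - i ≤ n then 2 * (x + 2 * n - i) - 1 else 2 * (i - x))

theorem zigzagIndex_comm (n x y : ℕ) : zigzagIndex n x y = zigzagIndex n y x := by
  simp only [zigzagIndex, add_comm, eq_comm]

theorem zigzagIndex_le {n x y : ℕ} (hx : x < 2 * n) (hy : y < 2 * n) :
    zigzagIndex n x y ≤ n := by
  unfold zigzagIndex
  split_ifs <;> omega

theorem eq_of_zigzagIndex_eq {n x y : ℕ} (hx : x < 2 * n) (hy : y < 2 * n)
    (h : zigzagIndex n x y = n) : x = y := by
  unfold zigzagIndex at h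
  split_ifs at h <;> omega

theorem zigzagLevel_adj {n i x y : ℕ} (hi : i < n) (hx : x < 2 * n) (hy : y < 2 * n)
    (h : zigzagIndex n x y = i) :
    zigzagLevel n i x = zigzagLevel n i y + 1 ∨ zigzagLevel n i y = zigzagLevel n i x + 1 := by
  unfold zigzagIndex at h
  unfold zigzagLevel
  split_ifs at * <;> omega

theorem zigzagLevel_injOn {n i x y : ℕ} (hi : i < n) (hx : x < 2 * n) (hy : y < 2 * n)
    (h : zigzagLevel n i x = zigzagLevel n i y) : x = y := by
  unfold zigzagLevel at h
  split_ifs at * <;> omega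

open Classical in
/-- A graph with a colouring by `2 * n` colours such that each vertex has at most `D` neighbours
in each colour decomposes into `(n + 1) * D` linear forests. -/
theorem exists_decomp_of_coloring [Fintype V] (G : SimpleGraph V) (n D : ℕ) (c : V → Fin (2 * n))
    (hc : ∀ v a, (Finset.univ.filter fun w => G.Adj v w ∧ c w = a).card ≤ D) :
    ∃ F : Fin (n + 1) × Fin D → SimpleGraph V, IsLinearForestDecomp G F := by
  let H : Fin (n + 1) → SimpleGraph V := fun i =>
    { Adj := fun u v => G.Adj u v ∧ zigzagIndex n (c u) (c v) = i
      symm := ⟨fun u v h => ⟨h.1.symm, by rw [zigzagIndex_comm]; exact h.2⟩⟩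
      loopless := ⟨fun u h => h.1.ne rfl⟩ }
  have hdec : ∀ i, ∃ F : Fin D → SimpleGraph V, IsLinearForestDecomp (H i) F := by
    intro i
    rcases lt_or_eq_of_le (Nat.lt_succ_iff.1 i.2) with hi | hi
    · have key : ∀ (v : V) (S : Finset V) (m : ℕ),
          (∀ w ∈ S, G.Adj v w ∧ zigzagLevel n i (c w) = m) → S.card ≤ D := by
        intro v S m hS
        rcases S.eq_empty_or_nonempty with h | ⟨w₀, hw₀⟩
        · simp [h]
        · refine (Finset.card_le_card fun w hw => ?_).trans (hc v (c w₀))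
          simp only [Finset.mem_filter, Finset.mem_univ, true_and]
          exact ⟨(hS w hw).1, Fin.ext (zigzagLevel_injOn hi (c w).2 (c w₀).2
            ((hS w hw).2.trans (hS w₀ hw₀).2.symm))⟩
      refine exists_decomp_of_labelling (H i) (fun v => zigzagLevel n i (c v)) D
        (fun u v h => ?_) (fun u => ?_) (fun v => ?_)
      · have := zigzagLevel_adj hi (c u).2 (c v).2 h.2
        omega
      · refine key u _ (zigzagLevel n i (c u) + 1) fun w hw => ?_
        simp only [Finset.mem_filter, Finset.mem_univ, true_and] at hw
        have := zigzagLevel_adj hi (c u).2 (c w).2 hw.1.2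
        exact ⟨hw.1.1, by omega⟩
      · refine key v _ (zigzagLevel n i (c v) - 1) fun w hw => ?_
        simp only [Finset.mem_filter, Finset.mem_univ, true_and] at hw
        have := zigzagLevel_adj hi (c w).2 (c v).2 hw.1.2
        exact ⟨hw.1.1.symm, by omega⟩
    · have hmono : ∀ u v, (H i).Adj u v → G.Adj u v ∧ c u = c v := fun u v h =>
        ⟨h.1, Fin.ext (eq_of_zigzagIndex_eq (c u).2 (c v).2 (h.2.trans hi))⟩
      refine exists_decomp_of_labelling (H i) (fun v => (Fintype.equivFin V v : ℕ)) D
        (fun u v h => ?_) (fun u => (Finset.card_le_card fun w hw => ?_).trans (hc u (c u)))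
        (fun v => (Finset.card_le_card fun w hw => ?_).trans (hc v (c v)))
      · simpa [Fin.ext_iff.symm] using h.ne
      · simp only [Finset.mem_filter, Finset.mem_univ, true_and] at hw ⊢
        exact ⟨(hmono _ _ hw.1).1, (hmono _ _ hw.1).2.symm⟩
      · simp only [Finset.mem_filter, Finset.mem_univ, true_and] at hw ⊢
        exact ⟨(hmono _ _ hw.1).1.symm, (hmono _ _ hw.1).2⟩
  choose F hF using hdec
  refine ⟨_, IsLinearForestDecomp.of_partition (H := H) (fun i u v h => h.1)
    (fun u v h => ?_) hF⟩
  exact ⟨⟨zigzagIndex n (c u) (c v), Nat.lt_succ_of_le (zigzagIndex_le (c u).2 (c v).2)⟩,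
    ⟨h, rfl⟩, fun j hj => Fin.ext hj.2.symm⟩

/-- The symmetric Lovász local lemma for the uniform measure on a finite set. The event `A i` has
conditional probability at most `q` given that all of the events in a family disjoint from `Γ i`
fail. -/
theorem exists_avoiding_of_local_bound {Ω I : Type*} [Fintype Ω] [Nonempty Ω] [DecidableEq Ω]
    [Fintype I] [DecidableEq I] (A : I → Finset Ω) (Γ : I → Finset I) (q : ℝ) (d : ℕ)
    (hΓ : ∀ i, (Γ i).card ≤ d) (hq : 0 ≤ q) (hqd : 4 * q * d ≤ 1) (hq2 : 2 * q < 1)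
    (hA : ∀ i J, Disjoint J (Γ i) →
      ((A i \ J.biUnion A).card : ℝ) ≤ q * ((J.biUnion A)ᶜ.card : ℝ)) :
    ∃ ω, ∀ i, ω ∉ A i := by
  have key : ∀ (n : ℕ) (J : Finset I), J.card = n → ∀ i,
      ((A i \ J.biUnion A).card : ℝ) ≤ 2 * q * ((J.biUnion A)ᶜ.card : ℝ) := by
    intro n
    induction n using Nat.strong_induction_on with
    | _ n ih =>
      intro J hJ i
      set K := J.filter fun j => j ∉ Γ i with hK
      have hKJ : K ⊆ J := Finset.filter_subset _ _
      have hKdisj : Disjoint K (Γ i) := by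
        rw [Finset.disjoint_left]
        exact fun j hj => (Finset.mem_filter.1 hj).2
      have hKA := hA i K hKdisj
      rcases eq_or_ne K J with h | h
      · rw [h] at hKA
        have : 0 ≤ q * ((J.biUnion A)ᶜ.card : ℝ) := by positivity
        linarith
      have hlt : K.card < n := hJ ▸ Finset.card_lt_card (hKJ.ssubset_of_ne h)
      have hmono : K.biUnion A ⊆ J.biUnion A := Finset.biUnion_subset_biUnion_of_subset_left A hKJ
      have h1 : ((A i \ J.biUnion A).card : ℝ) ≤ (A i \ K.biUnion A).card := by
        exact_mod_cast Finset.card_le_card (Finset.sdiff_subset_sdiff le_rfl hmono)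
      have hcover : (K.biUnion A)ᶜ ⊆
          (J.biUnion A)ᶜ ∪ (J ∩ Γ i).biUnion fun j => A j \ K.biUnion A := by
        intro ω hω
        by_cases hωJ : ω ∈ J.biUnion A
        · obtain ⟨j, hj, hωj⟩ := Finset.mem_biUnion.1 hωJ
          rw [Finset.mem_compl] at hω
          refine Finset.mem_union_right _ (Finset.mem_biUnion.2 ⟨j, ?_, by simp [hωj, hω]⟩)
          refine Finset.mem_inter.2 ⟨hj, ?_⟩
          by_contra hjΓ
          exact hω (Finset.mem_biUnion.2 ⟨j, Finset.mem_filter.2 ⟨hj, hjΓ⟩, hωj⟩)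
        · exact Finset.mem_union_left _ (Finset.mem_compl.2 hωJ)
      have h2 : ((K.biUnion A)ᶜ.card : ℝ) ≤ (J.biUnion A)ᶜ.card +
          ∑ j ∈ J ∩ Γ i, ((A j \ K.biUnion A).card : ℝ) := by
        exact_mod_cast (Finset.card_le_card hcover).trans ((Finset.card_union_le _ _).trans
          (Nat.add_le_add_left Finset.card_biUnion_le _))
      have h3 : ∑ j ∈ J ∩ Γ i, ((A j \ K.biUnion A).card : ℝ) ≤
          d * (2 * q * ((K.biUnion A)ᶜ.card : ℝ)) := by
        refine (Finset.sum_le_card_nsmul _ _ _ fun j _ => ih K.card hlt K rfl j).trans ?_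
        rw [nsmul_eq_mul]
        refine mul_le_mul_of_nonneg_right ?_ (by positivity)
        exact_mod_cast (Finset.card_le_card Finset.inter_subset_right).trans (hΓ i)
      have h4 : (0 : ℝ) ≤ (K.biUnion A)ᶜ.card := by positivity
      have h5 : ((K.biUnion A)ᶜ.card : ℝ) ≤ 2 * (J.biUnion A)ᶜ.card := by nlinarith
      nlinarith
  have hpos : ∀ J : Finset I, 0 < ((J.biUnion A)ᶜ.card : ℝ) := by
    intro J
    induction J using Finset.induction_on with
    | empty => simp [Fintype.card_pos]
    | insert i J _ ih =>
      have h1 := key _ J rfl i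
      have h2 : (J.biUnion A)ᶜ ⊆ ((insert i J).biUnion A)ᶜ ∪ (A i \ J.biUnion A) := by
        intro ω
        simp only [Finset.mem_compl, Finset.mem_union, Finset.biUnion_insert, Finset.mem_sdiff]
        tauto
      have h3 : ((J.biUnion A)ᶜ.card : ℝ) ≤
          ((insert i J).biUnion A)ᶜ.card + (A i \ J.biUnion A).card := by
        exact_mod_cast (Finset.card_le_card h2).trans (Finset.card_union_le _ _)
      nlinarith
  have h := hpos Finset.univ
  obtain ⟨ω, hω⟩ := Finset.card_pos.1 (by exact_mod_cast h)
  exact ⟨ω, by simpa using hω⟩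

open Classical in
/-- Sets of functions determined by the values on complementary sets of coordinates are
independent. -/
theorem card_filter_and_mul_card {V C : Type*} [Fintype V] [Fintype C] (S : Set V)
    (P Q : (V → C) → Prop)
    (hP : ∀ c c', (∀ v ∈ S, c v = c' v) → P c → P c')
    (hQ : ∀ c c', (∀ v ∉ S, c v = c' v) → Q c → Q c') :
    (Finset.univ.filter fun c => P c ∧ Q c).card * Fintype.card (V → C) =
      (Finset.univ.filter P).card * (Finset.univ.filter Q).card := by
  rw [← Finset.card_univ, ← Finset.card_product, ← Finset.card_product]
  let f : (V → C) × (V → C) → (V → C) × (V → C) := fun x =>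
    (fun v => if v ∈ S then x.1 v else x.2 v, fun v => if v ∈ S then x.2 v else x.1 v)
  have hf : ∀ x, f (f x) = x := by
    intro x
    ext v <;> by_cases h : v ∈ S <;> simp [f, h]
  refine Finset.card_nbij' f f ?_ ?_ (fun x _ => hf x) (fun x _ => hf x)
  · rintro x hx
    simp only [Finset.coe_product, Set.mem_prod, Finset.mem_coe, Finset.mem_filter,
      Finset.mem_univ, true_and, and_true] at hx ⊢
    exact ⟨hP x.1 _ (fun v hv => by simp [f, hv]) hx.1,
      hQ x.1 _ (fun v hv => by simp [f, hv]) hx.2⟩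
  · rintro x hx
    simp only [Finset.coe_product, Set.mem_prod, Finset.mem_coe, Finset.mem_filter,
      Finset.mem_univ, true_and, and_true] at hx ⊢
    exact ⟨hP x.1 _ (fun v hv => by simp [f, hv]) hx.1,
      hQ x.2 _ (fun v hv => by simp [f, hv]) hx.2⟩

open Classical in
/-- A Chernoff-type bound: the number of colourings in which at least `T` elements of `S` get the
colour `a`. -/
theorem card_colorings_mul_pow_le {V : Type*} [Fintype V] {p : ℕ} (hp : 0 < p) (S : Finset V)
    (a : Fin p) (T : ℕ) (x : ℝ) (hx : 1 ≤ x) :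
    ((Finset.univ.filter fun c : V → Fin p => T ≤ (S.filter fun w => c w = a).card).card : ℝ) *
      x ^ T ≤ Fintype.card (V → Fin p) * (1 + (x - 1) / p) ^ S.card := by
  have hp' : (p : ℝ) ≠ 0 := by positivity
  have hmgf : ∑ c : V → Fin p, x ^ (S.filter fun w => c w = a).card =
      Fintype.card (V → Fin p) * (1 + (x - 1) / p) ^ S.card := by
    let g : V → Fin p → ℝ := fun w j => if w ∈ S ∧ j = a then x else 1
    have h1 : ∀ c : V → Fin p, x ^ (S.filter fun w => c w = a).card = ∏ w, g w (c w) := by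
      intro c
      simp only [g]
      rw [Finset.prod_ite, Finset.prod_const, Finset.prod_const_one, mul_one]
      congr 2
      ext w
      simp
    have h2 : ∀ w, ∑ j, g w j = p * (if w ∈ S then 1 + (x - 1) / p else 1) := by
      intro w
      by_cases hw : w ∈ S
      · have : ∀ j, g w j = 1 + if j = a then x - 1 else 0 := by
          intro j; simp only [g, hw, true_and]; split_ifs <;> ring
        simp only [this, Finset.sum_add_distrib, hw, if_true]
        simp
        field_simp
      · simp [g, hw]
    simp_rw [h1]
    rw [← Fintype.prod_sum]
    simp_rw [h2]
    rw [Finset.prod_mul_distrib, Finset.prod_ite_mem]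
    simp
  rw [← hmgf, ← nsmul_eq_mul, ← Finset.sum_const]
  refine (Finset.sum_le_sum fun c hc => ?_).trans
    (Finset.sum_le_sum_of_subset_of_nonneg (Finset.subset_univ _) fun _ _ _ => by positivity)
  exact pow_le_pow_right₀ hx (Finset.mem_filter.1 hc).2

theorem exp_one_lt_one_add_inv_pow {s : ℕ} (hs : 0 < s) :
    Real.exp 1 < (1 + (s : ℝ)⁻¹) ^ (s + 1) := by
  have hs' : (0 : ℝ) < s := by exact_mod_cast hs
  have h1 : (s : ℝ) / (s + 1) < Real.exp (-((s : ℝ) + 1)⁻¹) := by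
    have h := Real.add_one_lt_exp (x := -((s : ℝ) + 1)⁻¹) (by
      rw [neg_ne_zero]; positivity)
    have h2 : (s : ℝ) / (s + 1) = -((s : ℝ) + 1)⁻¹ + 1 := by field_simp; ring
    rwa [h2]
  have h2 : ((s : ℝ) / (s + 1)) ^ (s + 1) < Real.exp (-1) := by
    refine (pow_lt_pow_left₀ h1 (by positivity) (Nat.succ_ne_zero s)).trans_eq ?_
    rw [← Real.exp_nat_mul]
    congr 1
    push_cast
    field_simp
  have h3 : 1 + (s : ℝ)⁻¹ = ((s : ℝ) / (s + 1))⁻¹ := by field_simp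
  rw [h3, inv_pow, lt_inv_comm₀ (Real.exp_pos 1) (by positivity), ← Real.exp_neg]
  exact h2

open Classical in
/-- For large `u`, a graph of maximum degree at most `p * s * u` has a colouring with `p` colours
in which each vertex has at most `(s + 1) * u` neighbours in each colour. -/
theorem exists_balanced_coloring (p s : ℕ) (hp : 0 < p) (hs : 0 < s) :
    ∃ u₀ : ℕ, ∀ u : ℕ, u₀ ≤ u → ∀ (V : Type) (_ : Fintype V) (G : SimpleGraph V),
      (∀ v, deg G v ≤ p * s * u) → ∃ c : V → Fin p, ∀ v a,
        (Finset.univ.filter fun w => G.Adj v w ∧ c w = a).card ≤ (s + 1) * u := by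
  set r : ℝ := Real.exp 1 / (1 + (s : ℝ)⁻¹) ^ (s + 1) with hr
  have hr0 : 0 < r := by positivity
  have hr1 : r < 1 := (div_lt_one (by positivity)).2 (exp_one_lt_one_add_inv_pow hs)
  have hlim : Filter.Tendsto (fun u : ℕ => (4 * p * (p * s) ^ 2 : ℝ) * ((u : ℝ) ^ 2 * r ^ u))
      Filter.atTop (nhds 0) := by
    simpa using (tendsto_pow_const_mul_const_pow_of_abs_lt_one 2
      (by rwa [abs_of_pos hr0])).const_mul (4 * p * (p * s) ^ 2 : ℝ)
  have hev := (hlim.eventually (gt_mem_nhds zero_lt_one)).and (Filter.eventually_ge_atTop 1)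
  obtain ⟨u₀, hu₀⟩ := Filter.eventually_atTop.1 hev
  refine ⟨u₀, fun u hu V _ G hG => ?_⟩
  obtain ⟨hsmall, hu1⟩ := hu₀ u hu
  have : Nonempty (Fin p) := ⟨⟨0, hp⟩⟩
  let N : V → Finset V := fun v => Finset.univ.filter fun w => G.Adj v w
  have hN : ∀ v, (N v).card ≤ p * s * u := by
    intro v
    have h := hG v
    rw [deg, Set.ncard_eq_toFinset_card'] at h
    convert h using 2
    ext w
    simp [N]
  let bad : V → (V → Fin p) → Prop := fun v c =>
    ∃ a, (s + 1) * u + 1 ≤ ((N v).filter fun w => c w = a).card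
  let A : V → Finset (V → Fin p) := fun v => Finset.univ.filter (bad v)
  let Γ : V → Finset V := fun v => (N v).biUnion N
  have hcardA : ∀ v, ((A v).card : ℝ) ≤ p * r ^ u * Fintype.card (V → Fin p) := by
    intro v
    have hx : (1 : ℝ) ≤ 1 + (s : ℝ)⁻¹ := by simp
    have hone : ∀ a : Fin p, ((Finset.univ.filter fun c : V → Fin p =>
        (s + 1) * u + 1 ≤ ((N v).filter fun w => c w = a).card).card : ℝ) ≤
        r ^ u * Fintype.card (V → Fin p) := by
      intro a
      have h := card_colorings_mul_pow_le hp (N v) a ((s + 1) * u + 1) _ hx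
      have h2 : (1 + (1 + (s : ℝ)⁻¹ - 1) / p) ^ (N v).card ≤ Real.exp 1 ^ u := by
        have hp' : (0 : ℝ) < p := by exact_mod_cast hp
        have hs' : (0 : ℝ) < s := by exact_mod_cast hs
        have h3 : 1 + (1 + (s : ℝ)⁻¹ - 1) / p ≤ Real.exp ((s : ℝ)⁻¹ / p) := by
          rw [add_sub_cancel_left, add_comm]
          exact Real.add_one_le_exp _
        calc _ ≤ Real.exp ((s : ℝ)⁻¹ / p) ^ (N v).card :=
              pow_le_pow_left₀ (by rw [add_sub_cancel_left]; positivity) h3 _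
          _ ≤ Real.exp ((s : ℝ)⁻¹ / p) ^ (p * s * u) :=
              pow_le_pow_right₀ (Real.one_le_exp (by positivity)) (hN v)
          _ = Real.exp 1 ^ u := by
              rw [← Real.exp_nat_mul, ← Real.exp_nat_mul]
              congr 1
              push_cast
              field_simp
      have h4 : ((1 + (s : ℝ)⁻¹) ^ (s + 1)) ^ u ≤ (1 + (s : ℝ)⁻¹) ^ ((s + 1) * u + 1) := by
        rw [← pow_mul]
        exact pow_le_pow_right₀ hx (Nat.le_succ _)
      rw [hr, div_pow, div_mul_eq_mul_div, le_div_iff₀ (by positivity)]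
      calc _ ≤ _ := mul_le_mul_of_nonneg_left h4 (by positivity)
        _ ≤ _ := h
        _ ≤ _ := mul_le_mul_of_nonneg_left h2 (by positivity)
        _ = _ := mul_comm _ _
    have hsub : A v ⊆ Finset.univ.biUnion fun a : Fin p => Finset.univ.filter
        fun c : V → Fin p => (s + 1) * u + 1 ≤ ((N v).filter fun w => c w = a).card := by
      intro c hc
      obtain ⟨a, ha⟩ := (Finset.mem_filter.1 hc).2
      exact Finset.mem_biUnion.2 ⟨a, Finset.mem_univ _, Finset.mem_filter.2 ⟨Finset.mem_univ _, ha⟩⟩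
    calc ((A v).card : ℝ) ≤ ∑ a : Fin p, ((Finset.univ.filter fun c : V → Fin p =>
          (s + 1) * u + 1 ≤ ((N v).filter fun w => c w = a).card).card : ℝ) := by
          exact_mod_cast (Finset.card_le_card hsub).trans Finset.card_biUnion_le
      _ ≤ _ := Finset.sum_le_card_nsmul _ _ _ fun a _ => hone a
      _ = _ := by simp [mul_assoc]
  have hΓ : ∀ v, (Γ v).card ≤ (p * s * u) * (p * s * u) := fun v =>
    Finset.card_biUnion_le.trans ((Finset.sum_le_card_nsmul _ _ _ fun w _ => hN w).trans
      (by simpa using Nat.mul_le_mul_right _ (hN v)))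
  have hqd : 4 * (p * r ^ u) * ((p * s * u * (p * s * u) : ℕ) : ℝ) ≤ 1 := by
    push_cast
    nlinarith [hsmall]
  have hd1 : (1 : ℝ) ≤ ((p * s * u * (p * s * u) : ℕ) : ℝ) := by
    exact_mod_cast Nat.one_le_iff_ne_zero.2 (by positivity)
  have hq0 : 0 ≤ (p : ℝ) * r ^ u := by positivity
  obtain ⟨c, hc⟩ := exists_avoiding_of_local_bound A Γ (p * r ^ u) _ hΓ hq0 hqd (by nlinarith) (by
    intro v J hJ
    have hind := card_filter_and_mul_card (N v : Set V) (bad v) (fun c => ∀ j ∈ J, ¬ bad j c)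
      (by
        rintro c c' h ⟨a, ha⟩
        refine ⟨a, ha.trans_eq ?_⟩
        congr 1
        exact Finset.filter_congr fun w hw => by rw [h w hw])
      (by
        rintro c c' h hc j hj ⟨a, ha⟩
        refine hc j hj ⟨a, ha.trans_eq ?_⟩
        congr 1
        refine Finset.filter_congr fun w hw => ?_
        rw [h w fun hwv => Finset.disjoint_left.1 hJ hj (Finset.mem_biUnion.2 ⟨w, hwv, ?_⟩)]
        simpa [N, SimpleGraph.adj_comm] using hw)
    have e1 : A v \ J.biUnion A =
        Finset.univ.filter fun c => bad v c ∧ ∀ j ∈ J, ¬ bad j c := by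
      ext c; simp [A]
    have e2 : (J.biUnion A)ᶜ = Finset.univ.filter fun c => ∀ j ∈ J, ¬ bad j c := by
      ext c; simp [A]
    rw [e1, e2]
    have hΩ : (0 : ℝ) < Fintype.card (V → Fin p) := by exact_mod_cast Fintype.card_pos
    refine le_of_mul_le_mul_right ?_ hΩ
    calc _ = ((A v).card : ℝ) *
          ((Finset.univ.filter fun c => ∀ j ∈ J, ¬ bad j c).card : ℝ) := by
            norm_cast
            convert hind
      _ ≤ _ := mul_le_mul_of_nonneg_right (hcardA v) (by positivity)
      _ = _ := by ring)
  refine ⟨c, fun v a => ?_⟩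
  have h := hc v
  simp only [A, bad, Finset.mem_filter, Finset.mem_univ, true_and, not_exists, not_le] at h
  have h' := h a
  rw [Finset.filter_filter] at h'
  exact Nat.lt_succ_iff.1 h'

/-- Alon's approximate linear arboricity theorem: for every
`ε > 0` there is `Δ₀` such that every graph of maximum degree at most
`Δ ≥ Δ₀` decomposes into at most `(1+ε)Δ/2` linear forests. -/
theorem approx_linear_arboricity :
    ∀ ε : ℝ, 0 < ε → ∃ Δ₀ : ℕ, ∀ Δ : ℕ, Δ₀ ≤ Δ →
      ∀ (W : Type) (_ : Fintype W) (G : SimpleGraph W),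
        (∀ v, deg G v ≤ Δ) →
        ∃ (m : ℕ) (F : Fin m → SimpleGraph W),
          (m : ℝ) ≤ (1 + ε) * Δ / 2 ∧
          (∀ i, F i ≤ G ∧ IsLinearForest (F i)) ∧
          (∀ i j, i ≠ j → Disjoint (F i).edgeSet (F j).edgeSet) ∧
          (⋃ i, (F i).edgeSet) = G.edgeSet := by
  intro ε hε
  obtain ⟨n, hn⟩ := exists_nat_gt (max 1 (6 / ε))
  have hn1 : (1 : ℝ) < n := (le_max_left _ _).trans_lt hn
  have hnε : 6 < ε * n := by
    have := (le_max_right _ _).trans_lt hn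
    rwa [div_lt_iff₀' hε] at this
  have hn0 : 0 < n := by exact_mod_cast (zero_lt_one.trans hn1)
  obtain ⟨u₀, hu₀⟩ := exists_balanced_coloring (2 * n) n (by omega) hn0
  obtain ⟨Δ₁, hΔ₁⟩ := exists_nat_gt (4 * ((n : ℝ) + 1) ^ 2 / ε)
  refine ⟨max (2 * n * n * u₀) Δ₁, fun Δ hΔ W _ G hG => ?_⟩
  have hpos : 0 < 2 * n * n := by positivity
  set u := Δ / (2 * n * n) + 1 with hu
  have hu₀u : u₀ ≤ u :=
    ((Nat.le_div_iff_mul_le hpos).2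
      ((mul_comm _ _).trans_le ((le_max_left _ _).trans hΔ))).trans (Nat.le_succ _)
  have hΔu : Δ ≤ 2 * n * n * u := (Nat.lt_mul_div_succ Δ hpos).le
  obtain ⟨c, hc⟩ := hu₀ u hu₀u W _ G fun v => (hG v).trans hΔu
  obtain ⟨F, hF⟩ := exists_decomp_of_coloring G n _ c hc
  refine ⟨(n + 1) * ((n + 1) * u), fun i => F (finProdFinEquiv.symm i), ?_,
    fun i => hF.1 _, fun i j hij => ?_, ?_⟩
  · have h1 : (2 * n * n : ℝ) * u ≤ Δ + 2 * n * n := by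
      have : 2 * n * n * u ≤ Δ + 2 * n * n := by
        rw [hu, mul_add, mul_one]
        exact Nat.add_le_add_right (Nat.mul_div_le _ _) _
      exact_mod_cast this
    have h2 : 4 * ((n : ℝ) + 1) ^ 2 ≤ ε * Δ := by
      have h3 : (Δ₁ : ℝ) ≤ Δ := by exact_mod_cast (le_max_right _ _).trans hΔ
      rw [div_lt_iff₀' hε] at hΔ₁
      exact hΔ₁.le.trans (mul_le_mul_of_nonneg_left h3 hε.le)
    have h4 : ((n : ℝ) + 1) ^ 2 ≤ (1 + ε / 2) * n ^ 2 := by nlinarith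
    have hn2 : (0 : ℝ) < 2 * n ^ 2 := by positivity
    refine le_of_mul_le_mul_right ?_ hn2
    push_cast
    calc ((n : ℝ) + 1) * ((n + 1) * u) * (2 * n ^ 2)
        = ((n : ℝ) + 1) ^ 2 * (2 * n * n * u) := by ring
      _ ≤ ((n : ℝ) + 1) ^ 2 * (Δ + 2 * n * n) := mul_le_mul_of_nonneg_left h1 (by positivity)
      _ = ((n : ℝ) + 1) ^ 2 * Δ + ((n : ℝ) + 1) ^ 2 * (2 * n ^ 2) := by ring
      _ ≤ (1 + ε / 2) * n ^ 2 * Δ + (ε * Δ / 4) * (2 * n ^ 2) :=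
          add_le_add (mul_le_mul_of_nonneg_right h4 (by positivity))
            (mul_le_mul_of_nonneg_right (by linarith) hn2.le)
      _ = (1 + ε) * Δ / 2 * (2 * n ^ 2) := by ring
  · rw [Set.disjoint_left]
    intro e
    induction e using Sym2.ind with
    | _ u v =>
      intro hi hj
      rw [mem_edgeSet] at hi hj
      exact hij (finProdFinEquiv.symm.injective
        ((hF.2 u v ((hF.1 _).1 hi)).unique hi hj))
  · ext e
    induction e using Sym2.ind with
    | _ u v =>
      simp only [Set.mem_iUnion, mem_edgeSet]
      refine ⟨fun ⟨i, hi⟩ => (hF.1 _).1 hi, fun h => ?_⟩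
      obtain ⟨x, hx, -⟩ := hF.2 u v h
      exact ⟨finProdFinEquiv x, by simpa using hx⟩
end Paper
end
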